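/- For every k ∈ ℕ and n ∈ ℕ, the finite-horizon value function π ↦ W_k(n,π) is concave on (0,1); consequently the value function π ↦ V(n,π) := lim_{k→∞} W_k(n,π) is concave on (0,1) for each fixed n. -/

import Mathlib

open MeasureTheory Real Set Filter

/-- The natural parameter domain of the exponential family generated by `ν`. -/
def expDom (ν : Measure ℝ) : Set ℝ :=
  {u : ℝ | Integrable (fun x => Real.exp (u * x)) ν}

/-- The cumulant generating function `B(u) = log ∫ e^{u x} dν(x)`. -/
noncomputable def cgf (ν : Measure ℝ) (u : ℝ) : ℝ :=
  Real.log (∫ x, Real.exp (u * x) ∂ν)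

/-- The (topological) support of a measure: points all of whose neighbourhoods
have nonzero measure. -/
def msupport (μ : MeasureTheory.Measure ℝ) : Set ℝ :=
  {x : ℝ | ∀ U ∈ nhds x, μ U ≠ 0}

/-- The normalizing constant `Z(n,y) = ∫ e^{uy - nB(u)} dμ(u)`. -/
noncomputable def Z (ν μ : Measure ℝ) (n : ℕ) (y : ℝ) : ℝ :=
  ∫ u, Real.exp (u * y - (n : ℝ) * cgf ν u) ∂μ

/-- The posterior probability `q(n,y) = P(Θ > θ₀ | Y_n = y)`. -/
noncomputable def q (ν μ : Measure ℝ) (θ₀ : ℝ) (n : ℕ) (y : ℝ) : ℝ :=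
  (∫ u in Set.Ioi θ₀, Real.exp (u * y - (n : ℝ) * cgf ν u) ∂μ) / Z ν μ n y

/-- The posterior distribution `μ_{n,y}(du) = e^{uy - nB(u)} μ(du) / Z(n,y)`. -/
noncomputable def post (ν μ : Measure ℝ) (n : ℕ) (y : ℝ) : Measure ℝ :=
  (ENNReal.ofReal (Z ν μ n y))⁻¹ •
    μ.withDensity (fun u => ENNReal.ofReal (Real.exp (u * y - (n : ℝ) * cgf ν u)))

/-- The one-step transition operator: `(T_n f)(p) = E_{n,p}[f(Π_{n+1})]`, where
`Y n p` is the point on the `p`-level curve at time `n`. -/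
noncomputable def T (ν μ : Measure ℝ) (θ₀ : ℝ) (Y : ℕ → ℝ → ℝ) (n : ℕ)
    (f : ℝ → ℝ) (p : ℝ) : ℝ :=
  ∫ x, f (q ν μ θ₀ (n + 1) (Y n p + x)) *
      (Z ν μ (n + 1) (Y n p + x) / Z ν μ n (Y n p)) ∂ν

/-- The finite-horizon value functions `W k n p`. -/
noncomputable def W (ν μ : Measure ℝ) (θ₀ : ℝ) (Y : ℕ → ℝ → ℝ) (c : ℝ) :
    ℕ → ℕ → ℝ → ℝ
  | 0, _, p => min p (1 - p)
  | k + 1, n, p =>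
      min (min p (1 - p)) (c + T ν μ θ₀ Y n (W ν μ θ₀ Y c k (n + 1)) p)

/-- The value function `V(n,p) = lim_k W_k(n,p) = ⨅ k, W_k(n,p)`. -/
noncomputable def Vfun (ν μ : Measure ℝ) (θ₀ : ℝ) (Y : ℕ → ℝ → ℝ) (c : ℝ)
    (n : ℕ) (p : ℝ) : ℝ :=
  ⨅ k : ℕ, W ν μ θ₀ Y c k n p


/-- Supporting lines of a concave function on `(0,1)`, described by their values at `0` and `1`. -/
lemma supp_lines (f : ℝ → ℝ) (hf : ConcaveOn ℝ (Set.Ioo 0 1) f)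
    (hf0 : ∀ t ∈ Set.Ioo (0:ℝ) 1, 0 ≤ f t) (hf1 : ∀ t ∈ Set.Ioo (0:ℝ) 1, f t ≤ min t (1 - t)) :
    ∃ α β : ℝ → ℝ, (∀ t ∈ Set.Ioo (0:ℝ) 1, 0 ≤ α t ∧ α t ≤ 1 ∧ 0 ≤ β t ∧ β t ≤ 1 ∧
      f t = α t * (1 - t) + β t * t ∧
      ∀ v ∈ Set.Ioo (0:ℝ) 1, f v ≤ α t * (1 - v) + β t * v) ∧
      MonotoneOn α (Set.Ioo 0 1) ∧ AntitoneOn β (Set.Ioo 0 1) := by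
  have key : ∀ t : ℝ, ∃ s : ℝ, t ∈ Set.Ioo (0:ℝ) 1 →
      ∀ v ∈ Set.Ioo (0:ℝ) 1, f v ≤ f t + s * (v - t) := by
    intro t
    by_cases ht : t ∈ Set.Ioo (0:ℝ) 1
    swap
    · exact ⟨0, fun h => absurd h ht⟩
    let S : Set ℝ := (fun v => (f v - f t) / (v - t)) '' Set.Ioo t 1
    have hb : ∀ w ∈ Set.Ioo 0 t, ∀ x ∈ S, x ≤ (f t - f w) / (t - w) := by
      rintro w hw x ⟨v, hv, rfl⟩
      exact hf.slope_anti_adjacent (x := w) (y := t) (z := v) ⟨hw.1, hw.2.trans ht.2⟩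
        ⟨ht.1.trans hv.1, hv.2⟩ hw.2 hv.1
    have hne : S.Nonempty := ⟨_, (t + 1) / 2, ⟨by linarith [ht.2], by linarith [ht.2]⟩, rfl⟩
    have hbdd : BddAbove S := ⟨_, hb (t / 2) ⟨by linarith [ht.1], by linarith [ht.1]⟩⟩
    refine ⟨sSup S, fun _ v hv => ?_⟩
    rcases lt_trichotomy v t with h | h | h
    · have := csSup_le hne (hb v ⟨hv.1, h⟩)
      rw [le_div_iff₀ (by linarith)] at this
      nlinarith
    · subst h; simp
    · have := le_csSup hbdd ⟨v, ⟨h, hv.2⟩, rfl⟩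
      rw [div_le_iff₀ (by linarith)] at this
      linarith
  choose s hs using key
  have hα0 : ∀ t ∈ Set.Ioo (0:ℝ) 1, 0 ≤ f t - s t * t := by
    intro t ht
    by_contra hneg
    push Not at hneg
    set a := f t - s t * t with ha
    have hlim : ∀ v ∈ Set.Ioo (0:ℝ) 1, 0 ≤ a + s t * v := fun v hv => by
      have := hs t ht v hv
      have := hf0 v hv
      rw [ha]; linarith
    have hspos : 0 < s t := by
      have := hlim (1/2) ⟨by norm_num, by norm_num⟩
      linarith
    have hv := hlim (min (1/2) (-a / (2 * s t))) ⟨lt_min (by norm_num) (by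
      apply div_pos <;> linarith), (min_le_left _ _).trans_lt (by norm_num)⟩
    have : s t * min (1/2) (-a / (2 * s t)) ≤ s t * (-a / (2 * s t)) :=
      mul_le_mul_of_nonneg_left (min_le_right _ _) hspos.le
    have h2 : s t * (-a / (2 * s t)) = -a / 2 := by field_simp
    linarith
  have hβ0 : ∀ t ∈ Set.Ioo (0:ℝ) 1, 0 ≤ f t + s t * (1 - t) := by
    intro t ht
    by_contra hneg
    push Not at hneg
    set a := f t + s t * (1 - t) with ha
    have hlim : ∀ v ∈ Set.Ioo (0:ℝ) 1, 0 ≤ a - s t * v := fun v hv => by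
      have := hs t ht (1 - v) ⟨by linarith [hv.2], by linarith [hv.1]⟩
      have := hf0 (1 - v) ⟨by linarith [hv.2], by linarith [hv.1]⟩
      rw [ha]; linarith
    have hspos : 0 < - s t := by
      have := hlim (1/2) ⟨by norm_num, by norm_num⟩
      linarith
    have hv := hlim (min (1/2) (-a / (2 * (-s t)))) ⟨lt_min (by norm_num) (by
      apply div_pos <;> linarith), (min_le_left _ _).trans_lt (by norm_num)⟩
    have : (-s t) * min (1/2) (-a / (2 * (-s t))) ≤ (-s t) * (-a / (2 * (-s t))) :=
      mul_le_mul_of_nonneg_left (min_le_right _ _) hspos.le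
    have h2 : (-s t) * (-a / (2 * (-s t))) = -a / 2 := by
      have : s t ≠ 0 := by linarith
      field_simp
    linarith
  have hanti : ∀ t ∈ Set.Ioo (0:ℝ) 1, ∀ v ∈ Set.Ioo (0:ℝ) 1, t < v → s v ≤ s t := by
    intro t ht v hv h
    have h1 := hs t ht v hv
    have h2 := hs v hv t ht
    nlinarith
  refine ⟨fun t => f t - s t * t, fun t => f t + s t * (1 - t), ?_, ?_, ?_⟩
  · intro t ht
    have a0 := hα0 t ht
    have b0 := hβ0 t ht
    have hm := hf1 t ht
    have hm1 := hm.trans (min_le_left _ _)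
    have hm2 := hm.trans (min_le_right _ _)
    have e : f t = (f t - s t * t) * (1 - t) + (f t + s t * (1 - t)) * t := by ring
    refine ⟨a0, ?_, b0, ?_, e, ?_⟩
    · have : (f t - s t * t) * (1 - t) ≤ 1 * (1 - t) := by
        have := mul_nonneg b0 ht.1.le
        linarith
      exact le_of_mul_le_mul_right this (by linarith [ht.2])
    · have : (f t + s t * (1 - t)) * t ≤ 1 * t := by
        have := mul_nonneg a0 (by linarith [ht.2] : 0 ≤ 1 - t)
        linarith
      exact le_of_mul_le_mul_right this ht.1
    · intro v hv
      have := hs t ht v hv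
      linarith
  · intro t ht v hv htv
    rcases htv.eq_or_lt with h | h
    · subst h; rfl
    · have h1 := hs v hv t ht
      have h2 := hanti t ht v hv h
      have := ht.1
      simp only
      nlinarith
  · intro t ht v hv htv
    rcases htv.eq_or_lt with h | h
    · subst h; rfl
    · have h1 := hs t ht v hv
      have h2 := hanti t ht v hv h
      have := hv.2
      simp only
      nlinarith

/-- Chebyshev-type inequality under a single crossing condition. -/
lemma crossing {X : Type*} [MeasurableSpace X] (m : Measure X) (h g : X → ℝ) (S : Set X)
    (hS : ∀ᵐ x ∂m, x ∈ S) (hh : Integrable h m) (hg : Integrable (fun x => h x * g x) m)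
    (h0 : ∫ x, h x ∂m = 0) (hg0 : ∀ x ∈ S, 0 ≤ g x)
    (hc : ∀ x ∈ S, ∀ x' ∈ S, 0 < h x → h x' ≤ 0 → g x ≤ g x') :
    ∫ x, h x * g x ∂m ≤ 0 := by
  by_cases hne : ∃ x ∈ S, h x ≤ 0
  · let R : Set ℝ := g '' {x | x ∈ S ∧ h x ≤ 0}
    have hRne : R.Nonempty := by
      obtain ⟨x, hx, hx'⟩ := hne
      exact ⟨_, x, ⟨hx, hx'⟩, rfl⟩
    have hRb : BddBelow R := ⟨0, by rintro _ ⟨x, hx, rfl⟩; exact hg0 x hx.1⟩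
    have h2 : ∫ x, (h x * g x - h x * sInf R) ∂m ≤ 0 := by
      apply integral_nonpos_of_ae
      filter_upwards [hS] with x hx
      simp only [Pi.zero_apply]
      rcases le_or_gt (h x) 0 with hx0 | hx0
      · have : sInf R ≤ g x := csInf_le hRb ⟨x, ⟨hx, hx0⟩, rfl⟩
        nlinarith
      · have : g x ≤ sInf R := le_csInf hRne (by
          rintro _ ⟨x', hx', rfl⟩
          exact hc x hx x' hx'.1 hx0 hx'.2)
        nlinarith
    rw [integral_sub hg (hh.mul_const _), integral_mul_const, h0] at h2
    linarith
  · push Not at hne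
    have hz : h =ᵐ[m] 0 := by
      rw [← integral_eq_zero_iff_of_nonneg_ae _ hh]
      · exact h0
      · filter_upwards [hS] with x hx using (hne x hx).le
    have : ∫ x, h x * g x ∂m = ∫ x, (0:ℝ) ∂m := by
      apply integral_congr_ae
      filter_upwards [hz] with x hx
      simp [hx]
    rw [this]; simp

lemma measurable_cgf (ν : Measure ℝ) [SigmaFinite ν] : Measurable (cgf ν) := by
  unfold cgf
  apply Real.measurable_log.comp
  apply StronglyMeasurable.measurable
  apply StronglyMeasurable.integral_prod_right (f := fun u x => Real.exp (u * x))
  apply Measurable.stronglyMeasurable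
  unfold Function.uncurry
  fun_prop

lemma ae_expDom (ν μ : Measure ℝ) [IsProbabilityMeasure μ]
    (hsupp : msupport μ ⊆ interior (expDom ν)) : ∀ᵐ u ∂μ, u ∈ expDom ν := by
  have h := Measure.measure_compl_support_of_innerRegular (μ := μ)
  have h' : ∀ᵐ u ∂μ, u ∈ μ.support := h
  filter_upwards [h'] with u hu
  apply interior_subset
  apply hsupp
  intro U hU
  exact ((Measure.mem_support_iff_forall u).1 hu U hU).ne'

/-- The density `p_u(x)`. -/
noncomputable def dens (ν : Measure ℝ) (u x : ℝ) : ℝ := Real.exp (u * x - cgf ν u)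

lemma mass_pos (ν : Measure ℝ) (hν : ν ≠ 0) {u : ℝ} (hu : u ∈ expDom ν) :
    0 < ∫ x, Real.exp (u * x) ∂ν := by
  rw [integral_pos_iff_support_of_nonneg (fun x => (Real.exp_pos _).le) hu]
  have : Function.support (fun x => Real.exp (u * x)) = Set.univ := by
    ext x; simp [Real.exp_ne_zero]
  rw [this]
  simpa [pos_iff_ne_zero] using hν

lemma dens_integrable (ν : Measure ℝ) {u : ℝ} (hu : u ∈ expDom ν) :
    Integrable (dens ν u) ν := by
  have : dens ν u = fun x => Real.exp (u * x) / Real.exp (cgf ν u) := by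
    ext x; rw [dens, Real.exp_sub]
  rw [this]
  exact Integrable.div_const hu _

lemma dens_integral (ν : Measure ℝ) (hν : ν ≠ 0) {u : ℝ} (hu : u ∈ expDom ν) :
    ∫ x, dens ν u x ∂ν = 1 := by
  have : dens ν u = fun x => Real.exp (u * x) / Real.exp (cgf ν u) := by
    ext x; rw [dens, Real.exp_sub]
  have hp := mass_pos ν hν hu
  rw [this, integral_div, cgf, Real.exp_log hp, div_self hp.ne']

/-- Conditional expectation of `α(X)` given the parameter `u`. -/
noncomputable def gfun (ν : Measure ℝ) (α : ℝ → ℝ) (u : ℝ) : ℝ := ∫ x, α x * dens ν u x ∂ν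

lemma gfun_nonneg (ν : Measure ℝ) (α : ℝ → ℝ) (hα : ∀ x, 0 ≤ α x) (u : ℝ) :
    0 ≤ gfun ν α u :=
  integral_nonneg fun x => mul_nonneg (hα x) (Real.exp_pos _).le

lemma alpha_dens_integrable (ν : Measure ℝ) (α : ℝ → ℝ) (hm : Measurable α)
    (hα : ∀ x, 0 ≤ α x ∧ α x ≤ 1) {u : ℝ} (hu : u ∈ expDom ν) :
    Integrable (fun x => α x * dens ν u x) ν := by
  apply Integrable.bdd_mul (c := 1) (dens_integrable ν hu) hm.aestronglyMeasurable
  filter_upwards with x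
  rw [Real.norm_eq_abs, abs_of_nonneg (hα x).1]
  exact (hα x).2

lemma dens_cross (ν : Measure ℝ) {u v x x' : ℝ} (huv : u ≤ v)
    (h1 : 0 < dens ν u x - dens ν v x) (h2 : dens ν u x' - dens ν v x' ≤ 0) : x ≤ x' := by
  have h1' : dens ν v x < dens ν u x := by linarith
  have h2' : dens ν u x' ≤ dens ν v x' := by linarith
  unfold dens at h1' h2'
  rw [Real.exp_lt_exp] at h1'
  rw [Real.exp_le_exp] at h2'
  by_contra hx
  push Not at hx
  nlinarith

lemma gfun_mono (ν : Measure ℝ) (hν : ν ≠ 0) (α : ℝ → ℝ) (hmono : Monotone α)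
    (hα : ∀ x, 0 ≤ α x ∧ α x ≤ 1) {u v : ℝ} (hu : u ∈ expDom ν) (hv : v ∈ expDom ν)
    (huv : u ≤ v) : gfun ν α u ≤ gfun ν α v := by
  have i1 := alpha_dens_integrable ν α hmono.measurable hα hu
  have i2 := alpha_dens_integrable ν α hmono.measurable hα hv
  have h := crossing ν (fun x => dens ν u x - dens ν v x) α Set.univ (by simp)
    ((dens_integrable ν hu).sub (dens_integrable ν hv))
    (by
      convert! i1.sub i2 using 1
      ext x; simp only [Pi.sub_apply]; ring)
    (by rw [integral_sub (dens_integrable ν hu) (dens_integrable ν hv),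
      dens_integral ν hν hu, dens_integral ν hν hv, sub_self])
    (fun x _ => (hα x).1) (fun x _ x' _ h1 h2 => hmono (dens_cross ν huv h1 h2))
  have e : ∫ x, (dens ν u x - dens ν v x) * α x ∂ν = gfun ν α u - gfun ν α v := by
    unfold gfun
    rw [← integral_sub i1 i2]
    congr 1; ext x; ring
  linarith

lemma gfun_anti (ν : Measure ℝ) (hν : ν ≠ 0) (α : ℝ → ℝ) (hanti : Antitone α)
    (hα : ∀ x, 0 ≤ α x ∧ α x ≤ 1) {u v : ℝ} (hu : u ∈ expDom ν) (hv : v ∈ expDom ν)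
    (huv : u ≤ v) : gfun ν α v ≤ gfun ν α u := by
  have hm : Monotone (fun x => 1 - α x) := fun a b hab => by
    have := hanti hab
    simp only; linarith
  have h := gfun_mono ν hν (fun x => 1 - α x) hm
    (fun x => ⟨by linarith [(hα x).2], by linarith [(hα x).1]⟩) hu hv huv
  have e : ∀ w ∈ expDom ν, gfun ν (fun x => 1 - α x) w = 1 - gfun ν α w := by
    intro w hw
    have i := integral_sub (dens_integrable ν hw)
      (alpha_dens_integrable ν α hanti.measurable hα hw)
    rw [dens_integral ν hν hw] at i
    unfold gfun
    rw [← i]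
    congr 1; ext x; ring
  rw [e u hu, e v hv] at h
  linarith

/-- Unnormalised posterior density. -/
noncomputable def ee (ν : Measure ℝ) (n : ℕ) (y u : ℝ) : ℝ :=
  Real.exp (u * y - (n : ℝ) * cgf ν u)

lemma ee_succ (ν : Measure ℝ) (n : ℕ) (y x u : ℝ) :
    ee ν (n + 1) (y + x) u = ee ν n y u * dens ν u x := by
  unfold ee dens
  rw [← Real.exp_add]
  congr 1; push_cast; ring

lemma fubini (ν m : Measure ℝ) [SigmaFinite ν] [IsFiniteMeasure m] (hν : ν ≠ 0)
    (hm : ∀ᵐ u ∂m, u ∈ expDom ν) (n : ℕ) (y : ℝ) (hi : Integrable (ee ν n y) m)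
    (α : ℝ → ℝ) (hαm : Measurable α) (hα : ∀ x, 0 ≤ α x ∧ α x ≤ 1) :
    Integrable (fun x => α x * Z ν m (n + 1) (y + x)) ν ∧
    ∫ x, α x * Z ν m (n + 1) (y + x) ∂ν = ∫ u, ee ν n y u * gfun ν α u ∂m ∧
    Integrable (fun u => ee ν n y u * gfun ν α u) m := by
  have hB := measurable_cgf ν
  have hG : Integrable (fun z : ℝ × ℝ => ee ν n y z.1 * dens ν z.1 z.2) (m.prod ν) := by
    have hmeas : Measurable (fun z : ℝ × ℝ => ee ν n y z.1 * dens ν z.1 z.2) := by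
      unfold ee dens; fun_prop
    rw [integrable_prod_iff hmeas.aestronglyMeasurable]
    constructor
    · filter_upwards [hm] with u hu
      exact (dens_integrable ν hu).const_mul _
    · apply hi.congr
      filter_upwards [hm] with u hu
      have : ∀ x, ‖ee ν n y u * dens ν u x‖ = ee ν n y u * dens ν u x := fun x =>
        Real.norm_of_nonneg (mul_nonneg (Real.exp_pos _).le (Real.exp_pos _).le)
      simp only [this]
      rw [integral_const_mul, dens_integral ν hν hu, mul_one]
  have hF : Integrable (fun z : ℝ × ℝ => α z.2 * (ee ν n y z.1 * dens ν z.1 z.2)) (m.prod ν) := by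
    apply Integrable.bdd_mul (c := 1) hG (hαm.comp measurable_snd).aestronglyMeasurable
    filter_upwards with z
    rw [Function.comp_apply, Real.norm_eq_abs, abs_of_nonneg (hα _).1]
    exact (hα _).2
  have e1 : ∀ x, ∫ u, α x * (ee ν n y u * dens ν u x) ∂m = α x * Z ν m (n + 1) (y + x) := by
    intro x
    rw [integral_const_mul]
    congr 1
    unfold Z
    congr 1; ext u
    exact (ee_succ ν n y x u).symm
  have e2 : ∀ u, ∫ x, α x * (ee ν n y u * dens ν u x) ∂ν = ee ν n y u * gfun ν α u := by
    intro u
    unfold gfun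
    rw [← integral_const_mul]
    congr 1; ext x; ring
  refine ⟨?_, ?_, ?_⟩
  · have := hF.integral_prod_right
    simpa only [e1] using this
  · have := integral_integral_swap (f := fun u x => α x * (ee ν n y u * dens ν u x)) hF
    simp only [e1, e2] at this
    exact this.symm
  · have := hF.integral_prod_left
    simpa only [e2] using this

lemma Z_pos (ν m : Measure ℝ) (hm : m ≠ 0) (n : ℕ) (y : ℝ) (hi : Integrable (ee ν n y) m) :
    0 < Z ν m n y := by
  have : 0 < ∫ u, ee ν n y u ∂m := by
    rw [integral_pos_iff_support_of_nonneg (f := ee ν n y) (fun x => (Real.exp_pos _).le) hi]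
    have : Function.support (ee ν n y) = Set.univ := by
      ext x; simp [ee, Real.exp_ne_zero]
    rw [this]
    simpa [pos_iff_ne_zero] using hm
  exact this

lemma q_mono (ν μ : Measure ℝ) (θ₀ : ℝ) (n : ℕ) (y y' : ℝ) (hyy : y ≤ y')
    (hi : ∀ y, Integrable (ee ν n y) μ)
    (hR : μ.restrict (Set.Ioi θ₀) ≠ 0) (hL : μ.restrict (Set.Iic θ₀) ≠ 0)
    (hZ : ∀ y, Z ν μ n y = Z ν (μ.restrict (Set.Ioi θ₀)) n y + Z ν (μ.restrict (Set.Iic θ₀)) n y) :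
    q ν μ θ₀ n y ≤ q ν μ θ₀ n y' := by
  change Z ν (μ.restrict (Set.Ioi θ₀)) n y / Z ν μ n y ≤
    Z ν (μ.restrict (Set.Ioi θ₀)) n y' / Z ν μ n y'
  have a := Z_pos ν _ hR n y (hi y).restrict
  have a' := Z_pos ν _ hR n y' (hi y').restrict
  have b := Z_pos ν _ hL n y (hi y).restrict
  have b' := Z_pos ν _ hL n y' (hi y').restrict
  set κ := Real.exp (θ₀ * (y' - y)) with hκ
  have hκp : 0 < κ := Real.exp_pos _
  have h1 : κ * Z ν (μ.restrict (Set.Ioi θ₀)) n y ≤ Z ν (μ.restrict (Set.Ioi θ₀)) n y' := by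
    unfold Z
    rw [← integral_const_mul]
    apply setIntegral_mono_on ((hi y).restrict.const_mul κ) (hi y').restrict measurableSet_Ioi
    intro u hu
    unfold ee
    rw [hκ, ← Real.exp_add, Real.exp_le_exp]
    have : θ₀ < u := hu
    nlinarith
  have h2 : Z ν (μ.restrict (Set.Iic θ₀)) n y' ≤ κ * Z ν (μ.restrict (Set.Iic θ₀)) n y := by
    unfold Z
    rw [← integral_const_mul]
    apply setIntegral_mono_on (hi y').restrict ((hi y).restrict.const_mul κ) measurableSet_Iic
    intro u hu
    unfold ee
    rw [hκ, ← Real.exp_add, Real.exp_le_exp]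
    have : u ≤ θ₀ := hu
    nlinarith
  rw [hZ, hZ, div_le_div_iff₀ (by linarith) (by linarith)]
  nlinarith [mul_le_mul_of_nonneg_right h1 b.le, mul_le_mul_of_nonneg_left h2 a.le]

/-- The set where a mixture of two exponentials lies below a third one is order-connected. -/
lemma hsign (ν : Measure ℝ) (n : ℕ) (y y1 y2 a b c : ℝ) (ha : 0 ≤ a) (hb : 0 ≤ b)
    {u v w : ℝ} (huv : u ≤ v) (hvw : v ≤ w)
    (hu : a * ee ν n y1 u + b * ee ν n y2 u - c * ee ν n y u ≤ 0)
    (hw : a * ee ν n y1 w + b * ee ν n y2 w - c * ee ν n y w ≤ 0) :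
    a * ee ν n y1 v + b * ee ν n y2 v - c * ee ν n y v ≤ 0 := by
  have e : ∀ z u, ee ν n z u = ee ν n y u * Real.exp (u * (z - y)) := by
    intro z u
    unfold ee; rw [← Real.exp_add]; congr 1; ring
  have hiff : ∀ u, a * ee ν n y1 u + b * ee ν n y2 u - c * ee ν n y u ≤ 0 ↔
      a * Real.exp (u * (y1 - y)) + b * Real.exp (u * (y2 - y)) ≤ c := by
    intro u
    have hp : 0 < ee ν n y u := Real.exp_pos _
    have : a * ee ν n y1 u + b * ee ν n y2 u - c * ee ν n y u =
        ee ν n y u * (a * Real.exp (u * (y1 - y)) + b * Real.exp (u * (y2 - y)) - c) := by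
      rw [e y1, e y2]; ring
    rw [this]
    constructor
    · intro h
      by_contra hn
      push Not at hn
      nlinarith [mul_pos hp (sub_pos.2 hn)]
    · intro h
      exact mul_nonpos_of_nonneg_of_nonpos hp.le (by linarith)
  rw [hiff] at hu hw ⊢
  have hconv : ConvexOn ℝ Set.univ
      (fun u : ℝ => a * Real.exp (u * (y1 - y)) + b * Real.exp (u * (y2 - y))) := by
    have h1 : ∀ t : ℝ, ConvexOn ℝ Set.univ (fun u : ℝ => Real.exp (u * t)) := fun t => by
      have := convexOn_exp.comp_linearMap (LinearMap.mulRight ℝ t)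
      simpa [Function.comp_def] using this
    exact ((h1 _).smul ha).add ((h1 _).smul hb)
  have := (hconv.convex_le c).ordConnected
  exact (this.out ⟨trivial, hu⟩ ⟨trivial, hw⟩ ⟨huv, hvw⟩).2

lemma exists_nonpos (m : Measure ℝ) (hm : m ≠ 0) (S : Set ℝ) (hS : ∀ᵐ x ∂m, x ∈ S) (h : ℝ → ℝ)
    (hh : Integrable h m) (h0 : ∫ x, h x ∂m = 0) : ∃ u ∈ S, h u ≤ 0 := by
  by_contra hne
  push Not at hne
  have hz : h =ᵐ[m] 0 := by
    rw [← integral_eq_zero_iff_of_nonneg_ae _ hh]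
    · exact h0
    · filter_upwards [hS] with x hx using (hne x hx).le
  have : ∀ᵐ x ∂m, False := by
    filter_upwards [hS, hz] with x hx hx'
    have := hne x hx
    rw [hx'] at this
    exact lt_irrefl _ this
  rw [eventually_false_iff_eq_bot, ae_eq_bot] at this
  exact hm this

/-- The one-step operator preserves concavity. -/
lemma T_concave (ν μ : Measure ℝ) [SigmaFinite ν]
    [IsProbabilityMeasure μ] (θ₀ : ℝ) (Y : ℕ → ℝ → ℝ) (n : ℕ)
    (hsupp : ∀ᵐ u ∂μ, u ∈ expDom ν)
    (hR : μ.restrict (Set.Ioi θ₀) ≠ 0) (hL : μ.restrict (Set.Iic θ₀) ≠ 0)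
    (hi : ∀ n y, Integrable (ee ν n y) μ)
    (hZ : ∀ n y, Z ν μ n y =
      Z ν (μ.restrict (Set.Ioi θ₀)) n y + Z ν (μ.restrict (Set.Iic θ₀)) n y)
    (hq : ∀ n y, q ν μ θ₀ n y ∈ Set.Ioo (0:ℝ) 1)
    (hY : ∀ p ∈ Set.Ioo (0 : ℝ) 1, q ν μ θ₀ n (Y n p) = p)
    (f : ℝ → ℝ) (hf : ConcaveOn ℝ (Set.Ioo 0 1) f)
    (hf0 : ∀ t ∈ Set.Ioo (0:ℝ) 1, 0 ≤ f t) (hf1 : ∀ t ∈ Set.Ioo (0:ℝ) 1, f t ≤ min t (1 - t)) :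
    ConcaveOn ℝ (Set.Ioo 0 1) (T ν μ θ₀ Y n f) := by
  by_cases hν : ν = 0
  · subst hν
    have : T 0 μ θ₀ Y n f = fun _ => 0 := by
      ext p; simp [T]
    rw [this]
    exact concaveOn_const 0 (convex_Ioo 0 1)
  obtain ⟨α, β, hαβ, hαm, hβa⟩ := supp_lines f hf hf0 hf1
  set mR := μ.restrict (Set.Ioi θ₀) with hmR
  set mL := μ.restrict (Set.Iic θ₀) with hmL
  have hqdef : ∀ n y, q ν μ θ₀ n y = Z ν mR n y / Z ν μ n y := fun n y => rfl
  have hRp : ∀ n y, 0 < Z ν mR n y := fun n y => Z_pos ν _ hR n y (hi n y).restrict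
  have hLp : ∀ n y, 0 < Z ν mL n y := fun n y => Z_pos ν _ hL n y (hi n y).restrict
  have hZp : ∀ n y, 0 < Z ν μ n y := fun n y => by rw [hZ]; linarith [hRp n y, hLp n y]
  have sR : ∀ᵐ u ∂mR, u ∈ expDom ν := ae_restrict_of_ae hsupp
  have sL : ∀ᵐ u ∂mL, u ∈ expDom ν := ae_restrict_of_ae hsupp
  have hqm : ∀ y, Monotone (fun x => q ν μ θ₀ (n + 1) (y + x)) := fun y x x' hx =>
    q_mono ν μ θ₀ (n + 1) _ _ (by linarith) (hi (n + 1)) hR hL (hZ (n + 1))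
  have hA : ∀ y, Monotone (fun x => α (q ν μ θ₀ (n + 1) (y + x))) := fun y x x' hx =>
    hαm (hq _ _) (hq _ _) (hqm y hx)
  have hB : ∀ y, Antitone (fun x => β (q ν μ θ₀ (n + 1) (y + x))) := fun y x x' hx =>
    hβa (hq _ _) (hq _ _) (hqm y hx)
  have hA1 : ∀ y x, 0 ≤ α (q ν μ θ₀ (n + 1) (y + x)) ∧ α (q ν μ θ₀ (n + 1) (y + x)) ≤ 1 :=
    fun y x => ⟨(hαβ _ (hq _ _)).1, (hαβ _ (hq _ _)).2.1⟩
  have hB1 : ∀ y x, 0 ≤ β (q ν μ θ₀ (n + 1) (y + x)) ∧ β (q ν μ θ₀ (n + 1) (y + x)) ≤ 1 :=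
    fun y x => ⟨(hαβ _ (hq _ _)).2.2.1, (hαβ _ (hq _ _)).2.2.2.1⟩
  have fL := fun y y' => fubini ν mL hν sL n y' (hi n y').restrict _ (hA y).measurable (hA1 y)
  have fR := fun y y' => fubini ν mR hν sR n y' (hi n y').restrict _ (hB y).measurable (hB1 y)
  -- pointwise identities and bounds
  have hle : ∀ y z : ℝ, ∀ t ∈ Set.Ioo (0:ℝ) 1, f (q ν μ θ₀ (n + 1) z) * Z ν μ (n + 1) z ≤
      α t * Z ν mL (n + 1) z + β t * Z ν mR (n + 1) z := by
    intro y z t ht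
    have h := (hαβ t ht).2.2.2.2.2 _ (hq (n + 1) z)
    have h' := mul_le_mul_of_nonneg_right h (hZp (n + 1) z).le
    have e1 : q ν μ θ₀ (n + 1) z * Z ν μ (n + 1) z = Z ν mR (n + 1) z := by
      rw [hqdef, div_mul_cancel₀ _ (hZp _ _).ne']
    have e2 := hZ (n + 1) z
    calc _ ≤ _ := h'
      _ = α t * (Z ν μ (n + 1) z - q ν μ θ₀ (n + 1) z * Z ν μ (n + 1) z) +
          β t * (q ν μ θ₀ (n + 1) z * Z ν μ (n + 1) z) := by ring
      _ = _ := by rw [e1, e2]; ring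
  have heq : ∀ z : ℝ, f (q ν μ θ₀ (n + 1) z) * Z ν μ (n + 1) z =
      α (q ν μ θ₀ (n + 1) z) * Z ν mL (n + 1) z + β (q ν μ θ₀ (n + 1) z) * Z ν mR (n + 1) z := by
    intro z
    have h := (hαβ _ (hq (n + 1) z)).2.2.2.2.1
    have e1 : q ν μ θ₀ (n + 1) z * Z ν μ (n + 1) z = Z ν mR (n + 1) z := by
      rw [hqdef, div_mul_cancel₀ _ (hZp _ _).ne']
    have e2 := hZ (n + 1) z
    calc _ = (α (q ν μ θ₀ (n + 1) z) * (1 - q ν μ θ₀ (n + 1) z) +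
          β (q ν μ θ₀ (n + 1) z) * q ν μ θ₀ (n + 1) z) * Z ν μ (n + 1) z := by rw [← h]
      _ = α (q ν μ θ₀ (n + 1) z) * (Z ν μ (n + 1) z - q ν μ θ₀ (n + 1) z * Z ν μ (n + 1) z) +
          β (q ν μ θ₀ (n + 1) z) * (q ν μ θ₀ (n + 1) z * Z ν μ (n + 1) z) := by ring
      _ = _ := by rw [e1, e2]; ring
  -- values of T
  let gA : ℝ → ℝ → ℝ := fun y => gfun ν (fun x => α (q ν μ θ₀ (n + 1) (y + x)))
  let gB : ℝ → ℝ → ℝ := fun y => gfun ν (fun x => β (q ν μ θ₀ (n + 1) (y + x)))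
  let J : ℝ → ℝ → ℝ := fun y y' =>
    ∫ u, ee ν n y' u * gA y u ∂mL + ∫ u, ee ν n y' u * gB y u ∂mR
  have hT : ∀ p, T ν μ θ₀ Y n f p =
      (∫ x, f (q ν μ θ₀ (n + 1) (Y n p + x)) * Z ν μ (n + 1) (Y n p + x) ∂ν) /
        Z ν μ n (Y n p) := by
    intro p
    unfold T
    rw [← integral_div]
    congr 1; ext x; ring
  have hint : ∀ y, Integrable
      (fun x => f (q ν μ θ₀ (n + 1) (y + x)) * Z ν μ (n + 1) (y + x)) ν := by
    intro y
    simp only [heq]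
    exact (fL y y).1.add (fR y y).1
  have hJ : ∀ y y', J y y' = ∫ x, (α (q ν μ θ₀ (n + 1) (y + x)) * Z ν mL (n + 1) (y' + x) +
      β (q ν μ θ₀ (n + 1) (y + x)) * Z ν mR (n + 1) (y' + x)) ∂ν := by
    intro y y'
    rw [integral_add (fL y y').1 (fR y y').1, (fL y y').2.1, (fR y y').2.1]
  have hTeq : ∀ p, T ν μ θ₀ Y n f p = J (Y n p) (Y n p) / Z ν μ n (Y n p) := by
    intro p
    rw [hT, hJ]
    simp only [heq]
  have hTle : ∀ y p, T ν μ θ₀ Y n f p ≤ J y (Y n p) / Z ν μ n (Y n p) := by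
    intro y p
    rw [hT, hJ]
    apply div_le_div_of_nonneg_right _ (hZp _ _).le
    apply integral_mono (hint _) ((fL y (Y n p)).1.add (fR y (Y n p)).1)
    intro x
    exact hle y _ _ (hq _ _)
  refine ⟨convex_Ioo 0 1, ?_⟩
  intro p1 hp1 p2 hp2 a b ha hb hab
  simp only [smul_eq_mul]
  set p := a * p1 + b * p2 with hp
  have hpI : p ∈ Set.Ioo (0:ℝ) 1 := convex_Ioo 0 1 hp1 hp2 ha hb hab
  set y := Y n p with hy
  set y1 := Y n p1 with hy1
  set y2 := Y n p2 with hy2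
  set Z0 := Z ν μ n y with hZ0
  set Z1 := Z ν μ n y1 with hZ1
  set Z2 := Z ν μ n y2 with hZ2
  have z0 : 0 < Z0 := hZp _ _
  have z1 : 0 < Z1 := hZp _ _
  have z2 : 0 < Z2 := hZp _ _
  let h : ℝ → ℝ := fun u => a / Z1 * ee ν n y1 u + b / Z2 * ee ν n y2 u - 1 / Z0 * ee ν n y u
  have hhi : Integrable h μ :=
    (((hi n y1).const_mul _).add ((hi n y2).const_mul _)).sub ((hi n y).const_mul _)
  have hlin : ∀ m : Measure ℝ, m ≤ μ → ∀ g : ℝ → ℝ,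
      Integrable (fun u => ee ν n y1 u * g u) m → Integrable (fun u => ee ν n y2 u * g u) m →
      Integrable (fun u => ee ν n y u * g u) m →
      Integrable (fun u => h u * g u) m ∧
      ∫ u, h u * g u ∂m = a / Z1 * ∫ u, ee ν n y1 u * g u ∂m + b / Z2 * ∫ u, ee ν n y2 u * g u ∂m
        - 1 / Z0 * ∫ u, ee ν n y u * g u ∂m := by
    intro m _ g i1 i2 i0
    have e : (fun u => h u * g u) = fun u => a / Z1 * (ee ν n y1 u * g u) +
        b / Z2 * (ee ν n y2 u * g u) - 1 / Z0 * (ee ν n y u * g u) := by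
      ext u; simp only [h]; ring
    rw [e]
    refine ⟨((i1.const_mul _).add (i2.const_mul _)).sub (i0.const_mul _), ?_⟩
    have j1 : Integrable (fun u => a / Z1 * (ee ν n y1 u * g u)) m := i1.const_mul _
    have j2 : Integrable (fun u => b / Z2 * (ee ν n y2 u * g u)) m := i2.const_mul _
    have j12 : Integrable (fun u => a / Z1 * (ee ν n y1 u * g u) +
        b / Z2 * (ee ν n y2 u * g u)) m := j1.add j2
    have j0 : Integrable (fun u => 1 / Z0 * (ee ν n y u * g u)) m := i0.const_mul _
    rw [integral_sub j12 j0, integral_add j1 j2, integral_const_mul, integral_const_mul,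
      integral_const_mul]
  have hRle : mR ≤ μ := Measure.restrict_le_self
  have hLle : mL ≤ μ := Measure.restrict_le_self
  have hqq : ∀ r ∈ Set.Ioo (0:ℝ) 1, Z ν mR n (Y n r) = r * Z ν μ n (Y n r) := by
    intro r hr
    have h := hY r hr
    rw [hqdef, div_eq_iff (hZp _ _).ne'] at h
    exact h
  have hmass : ∀ m : Measure ℝ, m ≤ μ → ∫ u, h u ∂m =
      a / Z1 * Z ν m n y1 + b / Z2 * Z ν m n y2 - 1 / Z0 * Z ν m n y := by
    intro m hm
    have := (hlin m hm (fun _ => 1) (by simpa using (hi n y1).mono_measure hm)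
      (by simpa using (hi n y2).mono_measure hm) (by simpa using (hi n y).mono_measure hm)).2
    simp only [mul_one] at this
    exact this
  have hmR0 : ∫ u, h u ∂mR = 0 := by
    rw [hmass mR hRle, hqq p1 hp1, hqq p2 hp2, hqq p hpI]
    change a / Z1 * (p1 * Z1) + b / Z2 * (p2 * Z2) - 1 / Z0 * (p * Z0) = 0
    rw [hp]
    field_simp
    ring
  have hmL0 : ∫ u, h u ∂mL = 0 := by
    have e : ∀ r ∈ Set.Ioo (0:ℝ) 1, Z ν mL n (Y n r) = (1 - r) * Z ν μ n (Y n r) := by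
      intro r hr
      have h1 := hqq r hr
      have h2 := hZ n (Y n r)
      linarith
    rw [hmass mL hLle, e p1 hp1, e p2 hp2, e p hpI]
    change a / Z1 * ((1 - p1) * Z1) + b / Z2 * ((1 - p2) * Z2) - 1 / Z0 * ((1 - p) * Z0) = 0
    rw [hp]
    have hb' : b = 1 - a := by linarith
    subst hb'
    field_simp
    ring
  have mIoi : ∀ᵐ u ∂mR, u ∈ Set.Ioi θ₀ := ae_restrict_mem measurableSet_Ioi
  have mIic : ∀ᵐ u ∂mL, u ∈ Set.Iic θ₀ := ae_restrict_mem measurableSet_Iic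
  obtain ⟨uR, huR, huR'⟩ := exists_nonpos mR hR _ mIoi h (hhi.mono_measure hRle) hmR0
  obtain ⟨uL, huL, huL'⟩ := exists_nonpos mL hL _ mIic h (hhi.mono_measure hLle) hmL0
  have hs : ∀ {u v w : ℝ}, u ≤ v → v ≤ w → h u ≤ 0 → h w ≤ 0 → h v ≤ 0 := by
    intro u v w huv hvw hu hw
    exact hsign ν n y y1 y2 _ _ _ (div_nonneg ha z1.le) (div_nonneg hb z2.le) huv hvw hu hw
  have linL := hlin mL hLle (gA y) (fL y y1).2.2 (fL y y2).2.2 (fL y y).2.2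
  have linR := hlin mR hRle (gB y) (fR y y1).2.2 (fR y y2).2.2 (fR y y).2.2
  have cL : ∫ u, h u * gA y u ∂mL ≤ 0 := by
    apply crossing mL h (gA y) (expDom ν ∩ Set.Iic θ₀) (sL.and mIic) (hhi.mono_measure hLle)
      linL.1 hmL0 (fun u _ => gfun_nonneg ν _ (fun x => (hA1 y x).1) u)
    intro u hu u' hu' h1 h2
    apply gfun_mono ν hν _ (hA y) (hA1 y) hu.1 hu'.1
    by_contra hlt
    push Not at hlt
    have : h u ≤ 0 := hs hlt.le (le_trans hu.2 (le_of_lt huR)) h2 huR'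
    linarith
  have cR : ∫ u, h u * gB y u ∂mR ≤ 0 := by
    apply crossing mR h (gB y) (expDom ν ∩ Set.Ioi θ₀) (sR.and mIoi) (hhi.mono_measure hRle)
      linR.1 hmR0 (fun u _ => gfun_nonneg ν _ (fun x => (hB1 y x).1) u)
    intro u hu u' hu' h1 h2
    apply gfun_anti ν hν _ (hB y) (hB1 y) hu'.1 hu.1
    by_contra hlt
    push Not at hlt
    have : h u ≤ 0 := hs (le_trans huL (le_of_lt hu.2)) hlt.le huL' h2
    linarith
  rw [linL.2] at cL
  rw [linR.2] at cR
  have t1 := mul_le_mul_of_nonneg_left (hTle y p1) ha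
  have t2 := mul_le_mul_of_nonneg_left (hTle y p2) hb
  have t0 := hTeq p
  have e1 : a * (J y (Y n p1) / Z ν μ n (Y n p1)) =
      a / Z1 * ∫ u, ee ν n y1 u * gA y u ∂mL + a / Z1 * ∫ u, ee ν n y1 u * gB y u ∂mR := by
    simp only [J, ← hy1, ← hZ1]; ring
  have e2 : b * (J y (Y n p2) / Z ν μ n (Y n p2)) =
      b / Z2 * ∫ u, ee ν n y2 u * gA y u ∂mL + b / Z2 * ∫ u, ee ν n y2 u * gB y u ∂mR := by
    simp only [J, ← hy2, ← hZ2]; ring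
  have e0 : J (Y n p) (Y n p) / Z ν μ n (Y n p) =
      1 / Z0 * ∫ u, ee ν n y u * gA y u ∂mL + 1 / Z0 * ∫ u, ee ν n y u * gB y u ∂mR := by
    simp only [J, ← hy, ← hZ0]; ring
  rw [e1] at t1
  rw [e2] at t2
  rw [e0] at t0
  linarith

/-- The finite-horizon value functions `p ↦ W_k(n,p)` are concave on `(0,1)`
for every `k` and `n`, and consequently the value function
`p ↦ V(n,p) = lim_k W_k(n,p)` is concave on `(0,1)` for each fixed `n`. -/
theorem value_function_concave (ν μ : Measure ℝ) [SigmaFinite ν]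
    [IsProbabilityMeasure μ] (θ₀ : ℝ) (Y : ℕ → ℝ → ℝ) (c : ℝ) (hc : 0 < c)
    (hsupp : msupport μ ⊆ interior (expDom ν))
    (h0 : 0 < μ (Set.Ioi θ₀)) (h1 : μ (Set.Ioi θ₀) < 1)
    (hint : ∀ (n : ℕ) (y : ℝ),
      Integrable (fun u => (1 + |u|) * Real.exp (u * y - (n : ℝ) * cgf ν u)) μ)
    (hY : ∀ (n : ℕ), ∀ p ∈ Set.Ioo (0 : ℝ) 1, q ν μ θ₀ n (Y n p) = p) :
    (∀ (k n : ℕ), ConcaveOn ℝ (Set.Ioo 0 1) (W ν μ θ₀ Y c k n)) ∧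
    (∀ n : ℕ, ConcaveOn ℝ (Set.Ioo 0 1) (Vfun ν μ θ₀ Y c n)) := by
  have hi : ∀ n y, Integrable (ee ν n y) μ := by
    intro n y
    have hB := measurable_cgf ν
    apply (hint n y).mono'
    · apply Measurable.aestronglyMeasurable
      unfold ee; fun_prop
    · filter_upwards with u
      have hp : 0 < ee ν n y u := Real.exp_pos _
      rw [Real.norm_of_nonneg hp.le]
      change ee ν n y u ≤ (1 + |u|) * ee ν n y u
      nlinarith [abs_nonneg u]
  have hR : μ.restrict (Set.Ioi θ₀) ≠ 0 := by
    rw [Ne, Measure.restrict_eq_zero]; exact h0.ne'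
  have hL : μ.restrict (Set.Iic θ₀) ≠ 0 := by
    rw [Ne, Measure.restrict_eq_zero, ← Set.compl_Ioi, prob_compl_eq_zero_iff measurableSet_Ioi]
    exact h1.ne
  have hZ : ∀ n y, Z ν μ n y =
      Z ν (μ.restrict (Set.Ioi θ₀)) n y + Z ν (μ.restrict (Set.Iic θ₀)) n y := by
    intro n y
    have := integral_add_compl (measurableSet_Ioi (a := θ₀)) (hi n y)
    rw [Set.compl_Ioi] at this
    exact this.symm
  have hq : ∀ n y, q ν μ θ₀ n y ∈ Set.Ioo (0:ℝ) 1 := by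
    intro n y
    have a := Z_pos ν _ hR n y (hi n y).restrict
    have b := Z_pos ν _ hL n y (hi n y).restrict
    change Z ν (μ.restrict (Set.Ioi θ₀)) n y / Z ν μ n y ∈ Set.Ioo (0:ℝ) 1
    rw [hZ]
    exact ⟨by positivity, by rw [div_lt_one (by linarith)]; linarith⟩
  have hZ0 : ∀ n y, 0 ≤ Z ν μ n y := fun n y => integral_nonneg fun u => (Real.exp_pos _).le
  have hmin : ConcaveOn ℝ (Set.Ioo (0:ℝ) 1) (fun p => min p (1 - p)) :=
    (concaveOn_id (convex_Ioo 0 1)).inf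
      ((concaveOn_const 1 (convex_Ioo 0 1)).sub (convexOn_id (convex_Ioo 0 1)))
  have main : ∀ k n, ConcaveOn ℝ (Set.Ioo 0 1) (W ν μ θ₀ Y c k n) ∧
      (∀ t ∈ Set.Ioo (0:ℝ) 1, 0 ≤ W ν μ θ₀ Y c k n t) ∧
      (∀ t ∈ Set.Ioo (0:ℝ) 1, W ν μ θ₀ Y c k n t ≤ min t (1 - t)) := by
    intro k
    induction k with
    | zero =>
      intro n
      refine ⟨hmin, ?_, fun t _ => le_rfl⟩
      intro t ht
      exact le_min ht.1.le (by linarith [ht.2])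
    | succ k ih =>
      intro n
      obtain ⟨i1, i2, i3⟩ := ih (n + 1)
      have hT := T_concave ν μ θ₀ Y n (ae_expDom ν μ hsupp) hR hL hi hZ hq (hY n) _ i1 i2 i3
      refine ⟨?_, ?_, ?_⟩
      · exact hmin.inf ((concaveOn_const c (convex_Ioo 0 1)).add hT)
      · intro t ht
        have : 0 ≤ T ν μ θ₀ Y n (W ν μ θ₀ Y c k (n + 1)) t :=
          integral_nonneg fun x => mul_nonneg (i2 _ (hq _ _)) (div_nonneg (hZ0 _ _) (hZ0 _ _))
        exact le_min (le_min ht.1.le (by linarith [ht.2])) (by linarith)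
      · intro t _
        exact min_le_left _ _
  refine ⟨fun k n => (main k n).1, fun n => ⟨convex_Ioo 0 1, ?_⟩⟩
  intro p1 hp1 p2 hp2 a b ha hb hab
  have hbdd : ∀ p ∈ Set.Ioo (0:ℝ) 1, BddBelow (Set.range fun k => W ν μ θ₀ Y c k n p) := by
    intro p hp
    exact ⟨0, by rintro _ ⟨k, rfl⟩; exact (main k n).2.1 p hp⟩
  unfold Vfun
  apply le_ciInf
  intro k
  refine le_trans ?_ ((main k n).1.2 hp1 hp2 ha hb hab)
  simp only [smul_eq_mul]
  exact add_le_add (mul_le_mul_of_nonneg_left (ciInf_le (hbdd p1 hp1) k) ha)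
    (mul_le_mul_of_nonneg_left (ciInf_le (hbdd p2 hp2) k) hb)
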